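/- arXiv:1506.04856 — 2 statements merged into one kernel-verified Lean document; each statement's English description precedes it below -/
import Mathlib

section
/- Let d ≥ 1, p > 0 and β < α < 2. The restriction of 𝔗_{β→α,p} to LTS^p_β ∩ 𝔇(𝔗_{β→α,p}) is a bijection from LTS^p_β ∩ 𝔇(𝔗_{β→α,p}) onto LTS^p_α. -/
open MeasureTheory Set

noncomputable section

variable {E : Type*} [NormedAddCommGroup E] [NormedSpace ℝ E]
  [MeasurableSpace E] [BorelSpace E]

/-- The upsilon transform with dilation measure `ρ` on `(0,∞) ⊆ ℝ`:
`[Υ_ρ M](B) = ∫ M(s⁻¹ B) ρ(ds)`, realized as the image of `ρ ⊗ M` under `(s, x) ↦ s • x`. -/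
def Upsilon (ρ : Measure ℝ) (M : Measure E) : Measure E :=
  Measure.map (fun sx : ℝ × E => sx.1 • sx.2) (ρ.prod M)

/-- `M` is a Lévy measure: σ-finite, no mass at `0`, and `∫ (|x|² ∧ 1) M(dx) < ∞`. -/
def IsLevyMeasure (M : Measure E) : Prop :=
  SigmaFinite M ∧ M {0} = 0 ∧
    ∫⁻ x, ENNReal.ofReal (min (‖x‖ ^ 2) 1) ∂M < ⊤

/-- The domain `𝔇(Υ_ρ)`: Lévy measures `M` such that `Υ_ρ M` is again a Lévy measure. -/
def UpsilonDomain (ρ : Measure ℝ) : Set (Measure E) :=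
  {M | IsLevyMeasure M ∧ IsLevyMeasure (Upsilon ρ M)}

/-- The range `ℜ(Υ_ρ) = {Υ_ρ M : M ∈ 𝔇(Υ_ρ)}`. -/
def UpsilonRange (ρ : Measure ℝ) : Set (Measure E) :=
  Upsilon ρ '' UpsilonDomain (E := E) ρ

/-- The class `𝔐^α`: Borel measures with `M({0}) = 0` and `∫ (|x|² ∧ |x|^α) M(dx) < ∞`. -/
def MemMAlpha (α : ℝ) (M : Measure E) : Prop :=
  M {0} = 0 ∧ ∫⁻ x, ENNReal.ofReal (min (‖x‖ ^ 2) (‖x‖ ^ α)) ∂M < ⊤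

/-- The class `𝔐^log`: Lévy measures with `∫_{|x|>1} log|x| M(dx) < ∞`. -/
def MemMLog (M : Measure E) : Prop :=
  IsLevyMeasure M ∧
    ∫⁻ x in {x : E | 1 < ‖x‖}, ENNReal.ofReal (Real.log ‖x‖) ∂M < ⊤

/-- The dilation measure `ψ_{α,p}(ds) = s^{-α-1} e^{-s^p} 1_{s>0} ds`. -/
def psiMeasure (α p : ℝ) : Measure ℝ :=
  (volume : Measure ℝ).withDensity fun s =>
    if 0 < s then ENNReal.ofReal (s ^ (-α - 1) * Real.exp (-(s ^ p))) else 0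

/-- `K_{α,β,p} = ∫₀^∞ u^{α-β-1} e^{-u^p} du`. -/
def Kconst (α β p : ℝ) : ℝ :=
  ∫ u in Ioi (0 : ℝ), u ^ (α - β - 1) * Real.exp (-(u ^ p))

/-- The dilation measure
`τ_{β→α,p}(ds) = K_{α,β,p}⁻¹ s^{-α-1} (1-s^p)^{(α-β)/p - 1} 1_{0<s<1} ds`. -/
def tauMeasure (β α p : ℝ) : Measure ℝ :=
  (volume : Measure ℝ).withDensity fun s =>
    if 0 < s ∧ s < 1 then
      ENNReal.ofReal ((Kconst α β p)⁻¹ * (s ^ (-α - 1) * (1 - s ^ p) ^ ((α - β) / p - 1)))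
    else 0

/-- `f` is the density of the fully right-skewed `r`-stable distribution on `(0,∞)`:
a nonnegative measurable function with `∫₀^∞ e^{-t x} f(x) dx = e^{-t^r}` for all `t ≥ 0`. -/
def IsStableDensity (r : ℝ) (f : ℝ → ℝ) : Prop :=
  Measurable f ∧ (∀ x, 0 ≤ f x) ∧
    ∀ t : ℝ, 0 ≤ t →
      ∫ x in Ioi (0 : ℝ), Real.exp (-(t * x)) * f x = Real.exp (-(t ^ r))

/-- The dilation measure `π_{α,p→q}(ds) = p f_{q/p}(s^{-p}) s^{-α-p-1} 1_{s>0} ds`,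
where `f` is (to be assumed) the density of the fully right-skewed `q/p`-stable law. -/
def piMeasure (f : ℝ → ℝ) (α p : ℝ) : Measure ℝ :=
  (volume : Measure ℝ).withDensity fun s =>
    if 0 < s then ENNReal.ofReal (p * f (s ^ (-p)) * s ^ (-α - p - 1)) else 0

/-- The measure `ρ(ds) = g(s) 1_{s>0} ds`. -/
def densMeasure (g : ℝ → ℝ) : Measure ℝ :=
  (volume : Measure ℝ).withDensity fun s => if 0 < s then ENNReal.ofReal (g s) else 0

open scoped ENNReal

section Upsilon

variable [SecondCountableTopology E]

theorem lintegral_Upsilon (ρ : Measure ℝ) [SFinite ρ] (M : Measure E) [SFinite M]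
    {f : E → ℝ≥0∞} (hf : Measurable f) :
    ∫⁻ x, f x ∂(Upsilon ρ M) = ∫⁻ s, ∫⁻ x, f (s • x) ∂M ∂ρ := by
  have hsmul : Measurable fun sx : ℝ × E => sx.1 • sx.2 := by fun_prop
  rw [Upsilon, lintegral_map hf hsmul]
  exact lintegral_prod _ (hf.comp hsmul).aemeasurable

instance sFinite_Upsilon (ρ : Measure ℝ) [SFinite ρ] (M : Measure E) [SFinite M] :
    SFinite (Upsilon ρ M) := by
  unfold Upsilon; infer_instance

end Upsilon

/-- The density of `psiMeasure`. -/
def psiDensity (α p s : ℝ) : ℝ≥0∞ :=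
  if 0 < s then ENNReal.ofReal (s ^ (-α - 1) * Real.exp (-(s ^ p))) else 0

/-- The density of `tauMeasure`. -/
def tauDensity (β α p s : ℝ) : ℝ≥0∞ :=
  if 0 < s ∧ s < 1 then
    ENNReal.ofReal ((Kconst α β p)⁻¹ * (s ^ (-α - 1) * (1 - s ^ p) ^ ((α - β) / p - 1)))
  else 0

theorem psiMeasure_eq (α p : ℝ) : psiMeasure α p = volume.withDensity (psiDensity α p) := rfl

theorem tauMeasure_eq (β α p : ℝ) :
    tauMeasure β α p = volume.withDensity (tauDensity β α p) := rfl

theorem measurable_psiDensity (α p : ℝ) : Measurable (psiDensity α p) := by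
  unfold psiDensity
  exact Measurable.ite measurableSet_Ioi (by fun_prop) measurable_const

theorem measurable_tauDensity (β α p : ℝ) : Measurable (tauDensity β α p) := by
  unfold tauDensity
  exact Measurable.ite measurableSet_Ioo (by fun_prop) measurable_const

instance sFinite_psiMeasure (α p : ℝ) : SFinite (psiMeasure α p) := by
  rw [psiMeasure_eq]; infer_instance

instance sFinite_tauMeasure (β α p : ℝ) : SFinite (tauMeasure β α p) := by
  rw [tauMeasure_eq]; infer_instance

theorem Kconst_pos {α β p : ℝ} (hβα : β < α) (hp : 0 < p) : 0 < Kconst α β p := by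
  rw [Kconst, integral_rpow_mul_exp_neg_rpow hp (by linarith)]
  have : 0 < (α - β - 1 + 1) / p := div_pos (by linarith) hp
  have := Real.Gamma_pos_of_pos this
  positivity

theorem lintegral_rpow_mul_exp_neg_rpow {α β p : ℝ} (hβα : β < α) (hp : 0 < p) :
    ∫⁻ w in Ioi (0 : ℝ), ENNReal.ofReal (w ^ (α - β - 1) * Real.exp (-(w ^ p))) =
      ENNReal.ofReal (Kconst α β p) := by
  rw [Kconst, ofReal_integral_eq_lintegral_ofReal
    (integrableOn_rpow_mul_exp_neg_rpow (by linarith) hp)]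
  filter_upwards [ae_restrict_mem measurableSet_Ioi] with w hw
  have : (0 : ℝ) < w := hw
  positivity

theorem lintegral_comp_mul_right_of_pos {h : ℝ → ℝ≥0∞} (hh : Measurable h) {u : ℝ} (hu : 0 < u) :
    ∫⁻ s, h (s * u) = ENNReal.ofReal u⁻¹ * ∫⁻ v, h v := by
  rw [← lintegral_map (μ := volume) (f := h) (g := fun s => s * u) hh (by fun_prop),
    Real.map_volume_mul_right hu.ne', lintegral_smul_measure, abs_of_pos (inv_pos.2 hu), smul_eq_mul]

/-- The pointwise identity behind the substitution `u = (w ^ p + v ^ p) ^ (1 / p)`. -/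
theorem tau_psi_substitution {α β p v w : ℝ} (hp : 0 < p) (hv : 0 < v) (hw : 0 < w) (K : ℝ) :
    p * w ^ (p - 1) * (1 / p) * (w ^ p + v ^ p) ^ (1 / p - 1) *
      (((w ^ p + v ^ p) ^ (1 / p)) ^ (-β - 1) *
        Real.exp (-(((w ^ p + v ^ p) ^ (1 / p)) ^ p)) *
        ((w ^ p + v ^ p) ^ (1 / p))⁻¹ *
        (K⁻¹ * ((v / (w ^ p + v ^ p) ^ (1 / p)) ^ (-α - 1) *
          (1 - (v / (w ^ p + v ^ p) ^ (1 / p)) ^ p) ^ ((α - β) / p - 1)))) =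
    K⁻¹ * (v ^ (-α - 1) * Real.exp (-(v ^ p))) * (w ^ (α - β - 1) * Real.exp (-(w ^ p))) := by
  have hq : 0 < w ^ p + v ^ p := by positivity
  obtain ⟨u, hu⟩ : ∃ u, u = (w ^ p + v ^ p) ^ (1 / p) := ⟨_, rfl⟩
  have hu0 : 0 < u := hu ▸ by positivity
  have hup : u ^ p = w ^ p + v ^ p := by
    rw [hu, ← Real.rpow_mul hq.le, one_div_mul_cancel hp.ne', Real.rpow_one]
  have h1 : (w ^ p + v ^ p) ^ (1 / p - 1) = u ^ (1 - p) := by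
    rw [← hup, ← Real.rpow_mul hu0.le]; congr 1; field_simp
  have h2 : 1 - (v / u) ^ p = (w / u) ^ p := by
    rw [Real.div_rpow hv.le hu0.le, Real.div_rpow hw.le hu0.le]
    have : u ^ p ≠ 0 := by positivity
    field_simp; linarith
  have h3 : Real.exp (-(u ^ p)) = Real.exp (-(v ^ p)) * Real.exp (-(w ^ p)) := by
    rw [← Real.exp_add, hup]; congr 1; ring
  rw [h1, ← hu, h2, h3, ← Real.rpow_mul (by positivity), Real.div_rpow hv.le hu0.le,
    Real.div_rpow hw.le hu0.le, mul_sub, mul_div_cancel₀ _ hp.ne', mul_one]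
  have hU : u ^ (1 - p) * u ^ (-β - 1) * u⁻¹ = u ^ (-α - 1) * u ^ (α - β - p) := by
    rw [← Real.rpow_neg_one u, ← Real.rpow_add hu0, ← Real.rpow_add hu0, ← Real.rpow_add hu0]
    congr 1; ring
  have hW : w ^ (p - 1) * w ^ (α - β - p) = w ^ (α - β - 1) := by
    rw [← Real.rpow_add hw]; congr 1; ring
  have e1 : u ^ (-α - 1) ≠ 0 := by positivity
  have e2 : u ^ (α - β - p) ≠ 0 := by positivity
  rw [← hW]
  calc _ = (p * (1 / p)) * (u ^ (1 - p) * u ^ (-β - 1) * u⁻¹) /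
        (u ^ (-α - 1) * u ^ (α - β - p)) * (K⁻¹ * (v ^ (-α - 1) * Real.exp (-(v ^ p)))) *
        (w ^ (p - 1) * w ^ (α - β - p) * Real.exp (-(w ^ p))) := by ring
    _ = _ := by rw [hU]; field_simp

theorem image_rpow_add_rpow {p v : ℝ} (hp : 0 < p) (hv : 0 < v) :
    (fun w : ℝ => (w ^ p + v ^ p) ^ (1 / p)) '' Ioi 0 = Ioi v := by
  have hvp : (v ^ p) ^ (1 / p) = v := by
    rw [← Real.rpow_mul hv.le, mul_one_div_cancel hp.ne', Real.rpow_one]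
  ext u
  constructor
  · rintro ⟨w, hw, rfl⟩
    have hw' : (0 : ℝ) < w := hw
    rw [mem_Ioi]
    conv_lhs => rw [← hvp]
    apply Real.rpow_lt_rpow (by positivity) _ (by positivity)
    have : 0 < w ^ p := by positivity
    linarith
  · intro hu
    have hu' : v < u := hu
    have hlt : v ^ p < u ^ p := Real.rpow_lt_rpow hv.le hu' hp
    refine ⟨(u ^ p - v ^ p) ^ (1 / p), Real.rpow_pos_of_pos (by linarith) _, ?_⟩
    simp only
    rw [← Real.rpow_mul (by linarith), one_div_mul_cancel hp.ne', Real.rpow_one, sub_add_cancel,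
      ← Real.rpow_mul (by linarith), mul_one_div_cancel hp.ne', Real.rpow_one]

theorem injOn_rpow_add_rpow {p v : ℝ} (hp : 0 < p) (hv : 0 < v) :
    InjOn (fun w : ℝ => (w ^ p + v ^ p) ^ (1 / p)) (Ioi 0) := by
  apply StrictMonoOn.injOn
  intro a ha b hb hab
  have ha' : (0 : ℝ) < a := ha
  have := Real.rpow_lt_rpow ha'.le hab hp
  exact Real.rpow_lt_rpow (by positivity) (by linarith) (by positivity)

theorem lintegral_psiDensity_mul_tauDensity {α β p : ℝ} (hβα : β < α) (hp : 0 < p) (v : ℝ) :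
    ∫⁻ u, psiDensity β p u * ENNReal.ofReal u⁻¹ * tauDensity β α p (v / u) =
      psiDensity α p v := by
  rcases le_or_gt v 0 with hv | hv
  · rw [psiDensity, if_neg hv.not_gt, lintegral_eq_zero_of_ae_eq_zero]
    refine ae_of_all _ fun u => ?_
    by_cases hu : 0 < u
    · have : ¬ (0 < v / u ∧ v / u < 1) := fun h => (div_nonpos_of_nonpos_of_nonneg hv hu.le).not_gt h.1
      simp [tauDensity, this]
    · simp [psiDensity, hu]
  set K := Kconst α β p with hK
  have hK0 : 0 < K := Kconst_pos hβα hp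
  set F : ℝ → ℝ := fun u => u ^ (-β - 1) * Real.exp (-(u ^ p)) * u⁻¹ *
    (K⁻¹ * ((v / u) ^ (-α - 1) * (1 - (v / u) ^ p) ^ ((α - β) / p - 1))) with hF
  have hind : (fun u => psiDensity β p u * ENNReal.ofReal u⁻¹ * tauDensity β α p (v / u)) =
      (Ioi v).indicator fun u => ENNReal.ofReal (F u) := by
    ext u
    by_cases hu : v < u
    · have hu0 : 0 < u := hv.trans hu
      have : 0 < v / u ∧ v / u < 1 := ⟨by positivity, (div_lt_one hu0).2 hu⟩
      rw [indicator_of_mem (mem_Ioi.2 hu), psiDensity, tauDensity, if_pos hu0, if_pos this,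
        ← ENNReal.ofReal_mul (by positivity), ← ENNReal.ofReal_mul (by positivity)]
    · rw [indicator_of_notMem (by simpa using hu)]
      by_cases hu0 : 0 < u
      · have : ¬ (0 < v / u ∧ v / u < 1) := fun h => hu ((div_lt_one hu0).1 h.2)
        simp [tauDensity, this]
      · simp [psiDensity, hu0]
  rw [hind, lintegral_indicator measurableSet_Ioi, ← image_rpow_add_rpow hp hv,
    lintegral_image_eq_lintegral_abs_deriv_mul measurableSet_Ioi
      (f' := fun w => p * w ^ (p - 1) * (1 / p) * (w ^ p + v ^ p) ^ (1 / p - 1)) ?_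
      (injOn_rpow_add_rpow hp hv)]
  · have : ∀ w ∈ Ioi (0 : ℝ), ENNReal.ofReal
          |p * w ^ (p - 1) * (1 / p) * (w ^ p + v ^ p) ^ (1 / p - 1)| *
          ENNReal.ofReal (F ((w ^ p + v ^ p) ^ (1 / p))) =
        ENNReal.ofReal (K⁻¹ * (v ^ (-α - 1) * Real.exp (-(v ^ p)))) *
          ENNReal.ofReal (w ^ (α - β - 1) * Real.exp (-(w ^ p))) := by
      intro w hw
      have hw0 : (0 : ℝ) < w := hw
      have hpos : 0 ≤ p * w ^ (p - 1) * (1 / p) * (w ^ p + v ^ p) ^ (1 / p - 1) := by positivity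
      rw [abs_of_nonneg hpos, ← ENNReal.ofReal_mul hpos, ← ENNReal.ofReal_mul (by positivity),
        ← tau_psi_substitution hp hv hw0 K]
    rw [setLIntegral_congr_fun measurableSet_Ioi this,
      lintegral_const_mul' _ _ ENNReal.ofReal_ne_top, lintegral_rpow_mul_exp_neg_rpow hβα hp,
      psiDensity, if_pos hv, ← ENNReal.ofReal_mul (by positivity), ← hK]
    congr 1
    field_simp
  · intro w hw
    have hw0 : (0 : ℝ) < w := hw
    have h1 : HasDerivAt (fun w : ℝ => w ^ p + v ^ p) (p * w ^ (p - 1)) w :=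
      (Real.hasDerivAt_rpow_const (Or.inl hw0.ne')).add_const _
    exact (h1.rpow_const (p := 1 / p) (Or.inl (by positivity))).hasDerivWithinAt

theorem lintegral_tauMeasure_psiMeasure {α β p : ℝ} (hβα : β < α) (hp : 0 < p)
    {G : ℝ → ℝ≥0∞} (hG : Measurable G) :
    ∫⁻ s, ∫⁻ u, G (s * u) ∂(psiMeasure β p) ∂(tauMeasure β α p) =
      ∫⁻ v, G v ∂(psiMeasure α p) := by
  have mA := measurable_tauDensity β α p
  have mB := measurable_psiDensity β p
  have mGm : Measurable fun x : ℝ × ℝ => G (x.1 * x.2) := by fun_prop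
  calc
    _ = ∫⁻ s, ∫⁻ u, tauDensity β α p s * (psiDensity β p u * G (s * u)) := by
      rw [tauMeasure_eq, lintegral_withDensity_eq_lintegral_mul _ mA
        (Measurable.lintegral_prod_right' mGm)]
      refine lintegral_congr fun s => ?_
      rw [lintegral_const_mul _ (by fun_prop), Pi.mul_apply, psiMeasure_eq,
        lintegral_withDensity_eq_lintegral_mul _ mB (by fun_prop)]
      rfl
    _ = ∫⁻ u, ∫⁻ s, tauDensity β α p s * (psiDensity β p u * G (s * u)) :=
      lintegral_lintegral_swap (by fun_prop)
    _ = ∫⁻ u, ∫⁻ v, psiDensity β p u * ENNReal.ofReal u⁻¹ * tauDensity β α p (v / u) * G v := by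
      refine lintegral_congr fun u => ?_
      by_cases hu : 0 < u
      · have := lintegral_comp_mul_right_of_pos
          (h := fun v => psiDensity β p u * tauDensity β α p (v / u) * G v) (by fun_prop) hu
        rw [← lintegral_const_mul _ (by fun_prop)] at this
        convert! this using 3 with s v
        · rw [mul_div_cancel_right₀ _ hu.ne']; ring
        · ring
      · simp [psiDensity, hu]
    _ = ∫⁻ v, ∫⁻ u, psiDensity β p u * ENNReal.ofReal u⁻¹ * tauDensity β α p (v / u) * G v :=
      lintegral_lintegral_swap (by fun_prop)
    _ = ∫⁻ v, psiDensity α p v * G v := by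
      refine lintegral_congr fun v => ?_
      rw [lintegral_mul_const _ (by fun_prop), lintegral_psiDensity_mul_tauDensity hβα hp]
    _ = _ := by
      rw [psiMeasure_eq, lintegral_withDensity_eq_lintegral_mul _ (measurable_psiDensity α p) hG]
      rfl

theorem Upsilon_tauMeasure_psiMeasure [SecondCountableTopology E] {α β p : ℝ} (hβα : β < α)
    (hp : 0 < p) (M : Measure E) [SFinite M] :
    Upsilon (tauMeasure β α p) (Upsilon (psiMeasure β p) M) = Upsilon (psiMeasure α p) M := by
  refine Measure.ext_of_lintegral _ fun f hf => ?_
  rw [lintegral_Upsilon _ _ hf, lintegral_Upsilon _ _ hf]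
  have hmeas : Measurable fun sx : ℝ × E => f (sx.1 • sx.2) := by fun_prop
  rw [← lintegral_tauMeasure_psiMeasure hβα hp (Measurable.lintegral_prod_right' hmeas)]
  refine lintegral_congr fun s => ?_
  rw [lintegral_Upsilon _ _ (by fun_prop)]
  simp only [smul_smul]

theorem ae_psiMeasure_pos (α p : ℝ) : ∀ᵐ s ∂(psiMeasure α p), 0 < s := by
  rw [psiMeasure_eq, ae_withDensity_iff (measurable_psiDensity α p)]
  refine ae_of_all _ fun s hs => ?_
  by_contra h
  exact hs (by simp [psiDensity, h])

omit [NormedSpace ℝ E] in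
/-- A measure without mass at the origin integrating `|x|² ∧ 1` is σ-finite. -/
theorem sigmaFinite_of_lintegral_min_lt_top {M : Measure E} (h0 : M {0} = 0)
    (h : ∫⁻ x, ENNReal.ofReal (min (‖x‖ ^ 2) 1) ∂M < ⊤) : SigmaFinite M := by
  set f : E → ℝ≥0∞ := fun x => ENNReal.ofReal (min (‖x‖ ^ 2) 1)
  have hf : Measurable f := by fun_prop
  have hne : ∀ᵐ x ∂M, f x ≠ 0 := by
    have : ∀ᵐ x ∂M, x ≠ 0 := by simpa [ae_iff] using h0
    filter_upwards [this] with x hx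
    have : 0 < ‖x‖ := norm_pos_iff.2 hx
    simp only [f, ne_eq, ENNReal.ofReal_eq_zero, not_le]
    positivity
  have : IsFiniteMeasure (M.withDensity f) := isFiniteMeasure_withDensity h.ne
  rw [← withDensity_inv_same hf hne (ae_of_all _ fun x => ENNReal.ofReal_ne_top)]
  refine SigmaFinite.withDensity_of_ne_top ?_
  rw [ae_withDensity_iff hf]
  exact ae_of_all _ fun x hx => ENNReal.inv_ne_top.2 hx

section

variable [SecondCountableTopology E]

theorem Upsilon_psiMeasure_zero (α p : ℝ) {M : Measure E} [SFinite M] (h0 : M {0} = 0) :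
    Upsilon (psiMeasure α p) M {0} = 0 := by
  rw [← lintegral_indicator_one (measurableSet_singleton _),
    lintegral_Upsilon _ _ (measurable_one.indicator (measurableSet_singleton _))]
  refine lintegral_eq_zero_of_ae_eq_zero ?_
  filter_upwards [ae_psiMeasure_pos α p] with s hs
  refine lintegral_eq_zero_of_ae_eq_zero ?_
  have : ∀ᵐ x ∂M, x ≠ 0 := by simpa [ae_iff] using h0
  filter_upwards [this] with x hx
  simp [hx, hs.ne']

theorem psiDensity_mul_min_le {α β p s r : ℝ} (hβα : β < α) :
    psiDensity β p s * ENNReal.ofReal (min ((s * r) ^ 2) 1) ≤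
      psiDensity α p s * ENNReal.ofReal (min ((s * r) ^ 2) 1) +
      (Ioi 0).indicator (fun s => ENNReal.ofReal (s ^ (2 - β - 1) * Real.exp (-(s ^ p)))) s *
        ENNReal.ofReal (min (r ^ 2) 1) := by
  by_cases hs : 0 < s
  · rw [psiDensity, psiDensity, if_pos hs, if_pos hs, indicator_of_mem (mem_Ioi.2 hs)]
    rcases le_or_gt s 1 with h1 | h1
    · refine le_add_right ?_
      gcongr ENNReal.ofReal (?_ * _) * _
      exact Real.rpow_le_rpow_of_exponent_ge hs h1 (by linarith)
    · refine le_add_left ?_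
      rw [← ENNReal.ofReal_mul (by positivity), ← ENNReal.ofReal_mul (by positivity)]
      apply ENNReal.ofReal_le_ofReal
      have hmin : min ((s * r) ^ 2) 1 ≤ s ^ 2 * min (r ^ 2) 1 := by
        rw [mul_min_of_nonneg _ _ (by positivity), mul_pow]
        exact min_le_min le_rfl (by nlinarith)
      have hpow : s ^ (2 - β - 1) = s ^ (-β - 1) * s ^ 2 := by
        rw [← Real.rpow_natCast, ← Real.rpow_add hs]; congr 1; push_cast; ring
      rw [hpow]
      calc _ ≤ s ^ (-β - 1) * Real.exp (-(s ^ p)) * (s ^ 2 * min (r ^ 2) 1) := by gcongr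
        _ = _ := by ring
  · simp [psiDensity, hs]

theorem lintegral_min_Upsilon_psiMeasure (α p : ℝ) (M : Measure E) [SFinite M] :
    ∫⁻ x, ENNReal.ofReal (min (‖x‖ ^ 2) 1) ∂(Upsilon (psiMeasure α p) M) =
      ∫⁻ s, ∫⁻ x, psiDensity α p s * ENNReal.ofReal (min ((s * ‖x‖) ^ 2) 1) ∂M := by
  rw [lintegral_Upsilon _ _ (by fun_prop), psiMeasure_eq,
    lintegral_withDensity_eq_lintegral_mul _ (measurable_psiDensity α p)
      (Measurable.lintegral_prod_right' (f := fun sx : ℝ × E =>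
        ENNReal.ofReal (min (‖sx.1 • sx.2‖ ^ 2) 1)) (by fun_prop))]
  refine lintegral_congr fun s => ?_
  rw [lintegral_const_mul _ (by fun_prop), Pi.mul_apply]
  simp only [norm_smul, mul_pow, Real.norm_eq_abs, sq_abs]

theorem isLevyMeasure_Upsilon_psiMeasure {α β p : ℝ} (hβα : β < α) (hα : α < 2) (hp : 0 < p)
    {M : Measure E} (hM : IsLevyMeasure M) (hαM : IsLevyMeasure (Upsilon (psiMeasure α p) M)) :
    IsLevyMeasure (Upsilon (psiMeasure β p) M) := by
  have := hM.1
  have h0 := Upsilon_psiMeasure_zero β p hM.2.1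
  have hint : ∫⁻ x, ENNReal.ofReal (min (‖x‖ ^ 2) 1) ∂(Upsilon (psiMeasure β p) M) < ⊤ := by
    have hα' := hαM.2.2
    rw [lintegral_min_Upsilon_psiMeasure] at hα' ⊢
    have mα := measurable_psiDensity α p
    set g := (Ioi (0 : ℝ)).indicator
      (fun s => ENNReal.ofReal (s ^ (2 - β - 1) * Real.exp (-(s ^ p)))) with hg
    have mg : Measurable g := Measurable.indicator (by fun_prop) measurableSet_Ioi
    calc _ ≤ ∫⁻ s, ∫⁻ x, (psiDensity α p s * ENNReal.ofReal (min ((s * ‖x‖) ^ 2) 1) +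
            g s * ENNReal.ofReal (min (‖x‖ ^ 2) 1)) ∂M :=
          lintegral_mono fun s => lintegral_mono fun x => psiDensity_mul_min_le hβα
      _ = (∫⁻ s, ∫⁻ x, psiDensity α p s * ENNReal.ofReal (min ((s * ‖x‖) ^ 2) 1) ∂M) +
            (∫⁻ s, g s) * ∫⁻ x, ENNReal.ofReal (min (‖x‖ ^ 2) 1) ∂M := by
          rw [← lintegral_mul_const _ mg, ← lintegral_add_right _ (by fun_prop)]
          refine lintegral_congr fun s => ?_
          rw [lintegral_add_right _ (by fun_prop), lintegral_const_mul (g s) (by fun_prop)]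
      _ < ⊤ := by
          refine ENNReal.add_lt_top.2 ⟨hα', ENNReal.mul_lt_top ?_ hM.2.2⟩
          rw [hg, lintegral_indicator measurableSet_Ioi,
            lintegral_rpow_mul_exp_neg_rpow (hβα.trans hα) hp]
          exact ENNReal.ofReal_lt_top
  exact ⟨sigmaFinite_of_lintegral_min_lt_top h0 hint, h0, hint⟩

end

open ProbabilityTheory Filter Topology in
theorem map_eq_of_frequently_mgf_eq {Ω : Type*} [MeasurableSpace Ω] {μ ν : Measure Ω}
    [IsFiniteMeasure μ] [IsFiniteMeasure ν] {X : Ω → ℝ} (hX : Measurable X)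
    (hμ : ∀ t < 1, Integrable (fun ω => Real.exp (t * X ω)) μ)
    (hν : ∀ t < 1, Integrable (fun ω => Real.exp (t * X ω)) ν)
    (h : ∃ᶠ t in 𝓝[≠] 0, mgf X μ t = mgf X ν t) : μ.map X = ν.map X := by
  set S : Set ℂ := {z | z.re ∈ Iio (1 : ℝ)} with hS
  have hsub : ∀ κ : Measure Ω, (∀ t < 1, Integrable (fun ω => Real.exp (t * X ω)) κ) →
      Iio (1 : ℝ) ⊆ interior (integrableExpSet X κ) := fun κ hκ =>
    interior_maximal (fun t ht => hκ t ht) isOpen_Iio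
  have hX' : AnalyticOnNhd ℂ (complexMGF X μ) S :=
    analyticOnNhd_complexMGF.mono fun z hz => hsub μ hμ hz
  have hY' : AnalyticOnNhd ℂ (complexMGF X ν) S :=
    analyticOnNhd_complexMGF.mono fun z hz => hsub ν hν hz
  have hS_conn : IsPreconnected S :=
    ((convex_Iio (1 : ℝ)).linear_preimage Complex.reLm).isPreconnected
  have hfreq : ∃ᶠ z in 𝓝[≠] (0 : ℂ), complexMGF X μ z = complexMGF X ν z := by
    have ht : Tendsto (fun t : ℝ => (t : ℂ)) (𝓝[≠] 0) (𝓝[≠] 0) := by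
      refine tendsto_nhdsWithin_iff.2 ⟨?_, ?_⟩
      · exact (Complex.continuous_ofReal.tendsto' 0 0 (by simp)).mono_left nhdsWithin_le_nhds
      · filter_upwards [self_mem_nhdsWithin] with t ht
        simpa using ht
    refine ht.frequently (h.mono fun t ht => ?_)
    rw [complexMGF_ofReal, complexMGF_ofReal, ht]
  have heq := hX'.eqOn_of_preconnected_of_frequently_eq hY' hS_conn (by simp [hS]) hfreq
  refine Measure.ext_of_charFun ?_
  ext t
  rw [← complexMGF_mul_I hX.aemeasurable, ← complexMGF_mul_I hX.aemeasurable]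
  exact heq (by simp [hS])

section

variable [SecondCountableTopology E]

theorem Upsilon_psiMeasure_restrict (α p : ℝ) (M : Measure E) [SFinite M] {C : Set E}
    (hC : MeasurableSet C) (hcone : ∀ s : ℝ, 0 < s → ∀ x, s • x ∈ C ↔ x ∈ C) :
    (Upsilon (psiMeasure α p) M).restrict C = Upsilon (psiMeasure α p) (M.restrict C) := by
  refine Measure.ext_of_lintegral _ fun f hf => ?_
  rw [← lintegral_indicator hC, lintegral_Upsilon _ _ (hf.indicator hC), lintegral_Upsilon _ _ hf]
  refine lintegral_congr_ae ?_
  filter_upwards [ae_psiMeasure_pos α p] with s hs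
  rw [← lintegral_indicator hC]
  refine lintegral_congr fun x => ?_
  by_cases hx : x ∈ C
  · rw [indicator_of_mem hx, indicator_of_mem ((hcone s hs x).2 hx)]
  · rw [indicator_of_notMem hx, indicator_of_notMem fun h => hx ((hcone s hs x).1 h)]

end

/-- The weight `|x|^α e^{-c |x|^{-p}}`. -/
def radialWeight (α p c : ℝ) (x : E) : ℝ≥0∞ :=
  ENNReal.ofReal (‖x‖ ^ α * Real.exp (-(c * ‖x‖ ^ (-p))))

omit [NormedSpace ℝ E] in
theorem measurable_radialWeight (α p c : ℝ) : Measurable (radialWeight (E := E) α p c) := by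
  unfold radialWeight; fun_prop

theorem psiDensity_div_mul_inv {α p v r : ℝ} (hr : 0 < r) :
    ENNReal.ofReal r⁻¹ * psiDensity α p (v / r) =
      (Ioi 0).indicator (fun v => ENNReal.ofReal (v ^ (-α - 1)) *
        ENNReal.ofReal (r ^ α * Real.exp (-(v ^ p * r ^ (-p))))) v := by
  by_cases hv : 0 < v
  · rw [psiDensity, if_pos (by positivity), indicator_of_mem (mem_Ioi.2 hv),
      ← ENNReal.ofReal_mul (by positivity), ← ENNReal.ofReal_mul (by positivity),
      Real.div_rpow hv.le hr.le, Real.div_rpow hv.le hr.le, Real.rpow_neg hr.le p,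
      Real.rpow_sub hr, Real.rpow_neg hr.le α, Real.rpow_one]
    congr 1
    have : r ^ α ≠ 0 := by positivity
    field_simp
  · have : ¬ 0 < v / r := fun h => hv ((div_pos_iff_of_pos_right hr).1 h)
    simp [psiDensity, this, hv]

section

variable [SecondCountableTopology E]

theorem lintegral_norm_Upsilon_psiMeasure (α p : ℝ) {M : Measure E} [SFinite M] (h0 : M {0} = 0)
    {φ : ℝ → ℝ≥0∞} (hφ : Measurable φ) :
    ∫⁻ x, φ ‖x‖ ∂(Upsilon (psiMeasure α p) M) =
      ∫⁻ v in Ioi 0, φ v *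
        (ENNReal.ofReal (v ^ (-α - 1)) * ∫⁻ x, radialWeight α p (v ^ p) x ∂M) := by
  have mψ := measurable_psiDensity α p
  have mw : Measurable fun vx : ℝ × E => radialWeight α p (vx.1 ^ p) vx.2 := by
    unfold radialWeight; fun_prop
  have mF : Measurable fun xv : E × ℝ => φ xv.2 *
      (ENNReal.ofReal (xv.2 ^ (-α - 1)) * radialWeight α p (xv.2 ^ p) xv.1) := by
    have := mw.comp (measurable_swap (α := E) (β := ℝ))
    exact (hφ.comp measurable_snd).mul
      (Measurable.mul (by fun_prop) this)
  calc
    _ = ∫⁻ s, ∫⁻ x, psiDensity α p s * φ ‖s • x‖ ∂M := by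
      rw [lintegral_Upsilon _ _ (by fun_prop), psiMeasure_eq,
        lintegral_withDensity_eq_lintegral_mul _ mψ
          (Measurable.lintegral_prod_right' (f := fun sx : ℝ × E => φ ‖sx.1 • sx.2‖)
            (by fun_prop))]
      refine lintegral_congr fun s => ?_
      rw [lintegral_const_mul _ (by fun_prop), Pi.mul_apply]
    _ = ∫⁻ x, (∫⁻ s : ℝ, psiDensity α p s * φ ‖s • x‖) ∂M :=
      lintegral_lintegral_swap (f := fun (s : ℝ) (x : E) => psiDensity α p s * φ ‖s • x‖)
        (by fun_prop)
    _ = ∫⁻ x, (∫⁻ v in Ioi (0 : ℝ), φ v * (ENNReal.ofReal (v ^ (-α - 1)) *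
          radialWeight α p (v ^ p) x)) ∂M := by
      have hne : ∀ᵐ x ∂M, x ≠ 0 := by simpa [ae_iff] using h0
      refine lintegral_congr_ae ?_
      filter_upwards [hne] with x hx
      have hr : 0 < ‖x‖ := norm_pos_iff.2 hx
      have := lintegral_comp_mul_right_of_pos
        (h := fun v => psiDensity α p (v / ‖x‖) * φ v) (by fun_prop) hr
      rw [← lintegral_const_mul _ (by fun_prop)] at this
      rw [← lintegral_indicator measurableSet_Ioi]
      convert! this using 3 with s v
      · rw [mul_div_cancel_right₀ _ hr.ne']
        by_cases hs : 0 < s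
        · rw [norm_smul, Real.norm_of_nonneg hs.le]
        · simp [psiDensity, hs]
      · rw [← mul_assoc, psiDensity_div_mul_inv hr]
        by_cases hv : v ∈ Ioi (0 : ℝ)
        · rw [indicator_of_mem hv, indicator_of_mem hv, radialWeight, mul_comm]
        · simp [indicator_of_notMem hv]
    _ = ∫⁻ v in Ioi 0, ∫⁻ x, φ v * (ENNReal.ofReal (v ^ (-α - 1)) *
          radialWeight α p (v ^ p) x) ∂M :=
      lintegral_lintegral_swap (f := fun (x : E) (v : ℝ) => φ v *
        (ENNReal.ofReal (v ^ (-α - 1)) * radialWeight α p (v ^ p) x)) mF.aemeasurable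
    _ = _ := by
      refine lintegral_congr fun v => ?_
      have := measurable_radialWeight (E := E) α p (v ^ p)
      rw [lintegral_const_mul _ (by fun_prop), lintegral_const_mul _ (by fun_prop)]

omit [NormedSpace ℝ E] [SecondCountableTopology E] in
theorem measurable_lintegral_radialWeight (α p : ℝ) (M : Measure E) [SFinite M] :
    Measurable fun v : ℝ => ∫⁻ x, radialWeight α p (v ^ p) x ∂M := by
  refine Measurable.lintegral_prod_right' (f := fun vx : ℝ × E =>
    radialWeight α p (vx.1 ^ p) vx.2) ?_
  unfold radialWeight; fun_prop

theorem lintegral_radialWeight_lt_top {α p : ℝ} (hp : 0 < p) {M : Measure E} [SFinite M]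
    (h0 : M {0} = 0)
    (h : ∫⁻ x, ENNReal.ofReal (min (‖x‖ ^ 2) 1) ∂(Upsilon (psiMeasure α p) M) < ⊤)
    {c : ℝ} (hc : 0 < c) : ∫⁻ x, radialWeight α p c x ∂M < ⊤ := by
  have mL := measurable_lintegral_radialWeight α p M
  rw [lintegral_norm_Upsilon_psiMeasure (φ := fun r => ENNReal.ofReal (min (r ^ 2) 1)) α p h0
    (by fun_prop)] at h
  have hae := ae_lt_top (by fun_prop) h.ne
  rw [ae_restrict_iff' measurableSet_Ioi] at hae
  have hcp : 0 < c ^ (1 / p) := by positivity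
  obtain ⟨v, hv, hfin⟩ := (Measure.dense_of_ae hae).inter_open_nonempty _
    (isOpen_Ioo (a := 0) (b := c ^ (1 / p))) (nonempty_Ioo.2 hcp)
  have hv0 : 0 < v := hv.1
  have hvp : v ^ p < c := by
    have := Real.rpow_lt_rpow hv0.le hv.2 hp
    rwa [← Real.rpow_mul hc.le, one_div_mul_cancel hp.ne', Real.rpow_one] at this
  have hfin' := hfin hv0
  rw [← mul_assoc, ← ENNReal.ofReal_mul (by positivity)] at hfin'
  refine lt_of_le_of_lt (lintegral_mono fun x => ?_)
    (ENNReal.lt_top_of_mul_ne_top_right hfin'.ne ?_)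
  · apply ENNReal.ofReal_le_ofReal
    gcongr
  · simp only [ne_eq, ENNReal.ofReal_eq_zero, not_le]
    positivity

theorem ae_lintegral_radialWeight_eq {α p : ℝ} {M N : Measure E} [SFinite M] [SFinite N]
    (hM0 : M {0} = 0) (hN0 : N {0} = 0)
    (h : Upsilon (psiMeasure α p) M = Upsilon (psiMeasure α p) N) :
    ∀ᵐ v ∂(volume : Measure ℝ), 0 < v →
      ∫⁻ x, radialWeight α p (v ^ p) x ∂M = ∫⁻ x, radialWeight α p (v ^ p) x ∂N := by
  have mM := measurable_lintegral_radialWeight α p M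
  have mN := measurable_lintegral_radialWeight α p N
  have hae : (fun v : ℝ => ENNReal.ofReal (v ^ (-α - 1)) * ∫⁻ x, radialWeight α p (v ^ p) x ∂M)
      =ᵐ[volume.restrict (Ioi 0)]
      fun v : ℝ => ENNReal.ofReal (v ^ (-α - 1)) * ∫⁻ x, radialWeight α p (v ^ p) x ∂N := by
    refine ae_eq_of_forall_setLIntegral_eq_of_sigmaFinite (by fun_prop) (by fun_prop)
      fun s hs _ => ?_
    have m1 : Measurable (s.indicator (1 : ℝ → ℝ≥0∞)) := measurable_one.indicator hs
    have e1 := lintegral_norm_Upsilon_psiMeasure α p hM0 m1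
    rw [h, lintegral_norm_Upsilon_psiMeasure α p hN0 m1] at e1
    rw [← lintegral_indicator hs, ← lintegral_indicator hs]
    convert! e1.symm using 3 with v v
    all_goals by_cases hv : v ∈ s <;> simp [hv]
  rw [Filter.EventuallyEq, ae_restrict_iff' measurableSet_Ioi] at hae
  filter_upwards [hae] with v hv hv0
  refine (ENNReal.mul_right_inj ?_ ENNReal.ofReal_ne_top).1 (hv hv0)
  simp only [ne_eq, ENNReal.ofReal_eq_zero, not_le]
  positivity

end

open ProbabilityTheory Filter Topology

omit [NormedSpace ℝ E] in
theorem lintegral_exp_withDensity_radialWeight {α p : ℝ} (M : Measure E) (t : ℝ) :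
    ∫⁻ x, ENNReal.ofReal (Real.exp (t * ‖x‖ ^ (-p))) ∂(M.withDensity (radialWeight α p 1)) =
      ∫⁻ x, radialWeight α p (1 - t) x ∂M := by
  rw [lintegral_withDensity_eq_lintegral_mul _ (measurable_radialWeight α p 1) (by fun_prop)]
  refine lintegral_congr fun x => ?_
  rw [Pi.mul_apply, radialWeight, radialWeight, ← ENNReal.ofReal_mul (by positivity), mul_assoc,
    ← Real.exp_add]
  ring_nf

omit [NormedSpace ℝ E] in
theorem mgf_withDensity_radialWeight {α p : ℝ} (M : Measure E) (t : ℝ) :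
    mgf (fun x => ‖x‖ ^ (-p)) (M.withDensity (radialWeight α p 1)) t =
      (∫⁻ x, radialWeight α p (1 - t) x ∂M).toReal := by
  rw [mgf, integral_eq_lintegral_of_nonneg_ae (ae_of_all _ fun x => by positivity)
    (Measurable.aestronglyMeasurable (by fun_prop)), lintegral_exp_withDensity_radialWeight]

omit [NormedSpace ℝ E] in
theorem integrable_exp_withDensity_radialWeight {α p : ℝ} {M : Measure E}
    (h : ∀ c, 0 < c → ∫⁻ x, radialWeight α p c x ∂M < ⊤) (t : ℝ) (ht : t < 1) :
    Integrable (fun x => Real.exp (t * ‖x‖ ^ (-p))) (M.withDensity (radialWeight α p 1)) := by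
  refine ⟨Measurable.aestronglyMeasurable (by fun_prop), ?_⟩
  rw [hasFiniteIntegral_iff_ofReal (ae_of_all _ fun x => by positivity),
    lintegral_exp_withDensity_radialWeight]
  exact h _ (by linarith)

omit [NormedSpace ℝ E] in
theorem map_withDensity_radialWeight_eq {α p : ℝ} (hp : 0 < p) {M N : Measure E}
    (hM : ∀ c, 0 < c → ∫⁻ x, radialWeight α p c x ∂M < ⊤)
    (hN : ∀ c, 0 < c → ∫⁻ x, radialWeight α p c x ∂N < ⊤)
    (h : ∀ᵐ v ∂(volume : Measure ℝ), 0 < v →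
      ∫⁻ x, radialWeight α p (v ^ p) x ∂M = ∫⁻ x, radialWeight α p (v ^ p) x ∂N) :
    (M.withDensity (radialWeight α p 1)).map (fun x => ‖x‖ ^ (-p)) =
      (N.withDensity (radialWeight α p 1)).map (fun x => ‖x‖ ^ (-p)) := by
  have := isFiniteMeasure_withDensity (hM 1 one_pos).ne
  have := isFiniteMeasure_withDensity (hN 1 one_pos).ne
  refine map_eq_of_frequently_mgf_eq (by fun_prop) (integrable_exp_withDensity_radialWeight hM)
    (integrable_exp_withDensity_radialWeight hN) ?_
  have hne : ∀ᵐ v ∂(volume : Measure ℝ), v ≠ 1 := by simp [ae_iff]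
  have hfreq : ∃ᶠ v in 𝓝 (1 : ℝ), v ≠ 1 ∧ (0 < v →
      ∫⁻ x, radialWeight α p (v ^ p) x ∂M = ∫⁻ x, radialWeight α p (v ^ p) x ∂N) :=
    mem_closure_iff_frequently.1 (Measure.dense_of_ae (hne.and h) 1)
  have ht : Tendsto (fun v : ℝ => 1 - v ^ p) (𝓝 1) (𝓝 0) := by
    have : ContinuousAt (fun v : ℝ => 1 - v ^ p) 1 :=
      continuousAt_const.sub (Real.continuousAt_rpow_const _ _ (Or.inl one_ne_zero))
    simpa [ContinuousAt] using this
  rw [frequently_nhdsWithin_iff]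
  refine ht.frequently ((hfreq.and_eventually (Ioi_mem_nhds one_pos)).mono ?_)
  rintro v ⟨⟨hv1, hv⟩, hv0⟩
  have hv0' : (0 : ℝ) < v := hv0
  refine ⟨?_, ?_⟩
  · rw [mgf_withDensity_radialWeight, mgf_withDensity_radialWeight, sub_sub_cancel, hv hv0]
  · intro h1
    have h1' : v ^ p = 1 := by
      have : 1 - v ^ p = 0 := h1
      linarith
    exact hv1 ((Real.rpow_left_inj hv0'.le zero_le_one hp.ne').1 (by rw [h1', Real.one_rpow]))

omit [MeasurableSpace E] [BorelSpace E] in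
theorem rpow_smul_polar {p : ℝ} (hp : 0 < p) (x : E) :
    (‖x‖ ^ (-p)) ^ (-1 / p) • (‖x‖⁻¹ • x) = x := by
  rcases eq_or_ne x 0 with rfl | hx
  · simp
  have hr : 0 < ‖x‖ := norm_pos_iff.2 hx
  rw [← Real.rpow_mul hr.le, show -p * (-1 / p) = 1 by field_simp, Real.rpow_one,
    smul_inv_smul₀ hr.ne']

omit [MeasurableSpace E] [BorelSpace E] in
theorem norm_inv_smul_smul {s : ℝ} (hs : 0 < s) (x : E) :
    ‖s • x‖⁻¹ • (s • x) = ‖x‖⁻¹ • x := by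
  rw [norm_smul, Real.norm_of_nonneg hs.le, smul_smul]
  congr 1
  field_simp

/-- `Ψ_{α,p}` is injective on its domain. -/
theorem Upsilon_psiMeasure_injOn [SecondCountableTopology E] {α p : ℝ} (hp : 0 < p) :
    InjOn (Upsilon (E := E) (psiMeasure α p)) (UpsilonDomain (psiMeasure α p)) := by
  rintro M ⟨hM, hΨM⟩ N ⟨hN, hΨN⟩ h
  have := hM.1
  have := hN.1
  have hMc := fun c hc => lintegral_radialWeight_lt_top (c := c) hp hM.2.1 hΨM.2.2 hc
  have hNc := fun c hc => lintegral_radialWeight_lt_top (c := c) hp hN.2.1 hΨN.2.2 hc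
  have mw := measurable_radialWeight (E := E) α p 1
  have := isFiniteMeasure_withDensity (hMc 1 one_pos).ne
  have := isFiniteMeasure_withDensity (hNc 1 one_pos).ne
  have mθ : Measurable fun x : E => ‖x‖⁻¹ • x := by fun_prop
  have mX : Measurable fun x : E => ‖x‖ ^ (-p) := by fun_prop
  have mP : Measurable fun x : E => (‖x‖⁻¹ • x, ‖x‖ ^ (-p)) := mθ.prodMk mX
  have mQ : Measurable fun y : E × ℝ => y.2 ^ (-1 / p) • y.1 := by fun_prop
  have hpolar : (M.withDensity (radialWeight α p 1)).map (fun x => (‖x‖⁻¹ • x, ‖x‖ ^ (-p))) =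
      (N.withDensity (radialWeight α p 1)).map (fun x => (‖x‖⁻¹ • x, ‖x‖ ^ (-p))) := by
    refine Measure.ext_prod fun {B A} hB hA => ?_
    have hC := mθ hB
    set C := (fun x : E => ‖x‖⁻¹ • x) ⁻¹' B with hCdef
    have hcone : ∀ s : ℝ, 0 < s → ∀ x, s • x ∈ C ↔ x ∈ C := fun s hs x => by
      simp only [hCdef, mem_preimage, norm_inv_smul_smul hs x]
    have hres : ∀ L : Measure E, (L.withDensity (radialWeight α p 1)).map
        (fun x => (‖x‖⁻¹ • x, ‖x‖ ^ (-p))) (B ×ˢ A) =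
        ((L.restrict C).withDensity (radialWeight α p 1)).map (fun x => ‖x‖ ^ (-p)) A := by
      intro L
      rw [Measure.map_apply mP (hB.prod hA), Measure.map_apply mX hA, ← restrict_withDensity hC,
        Measure.restrict_apply (mX hA)]
      congr 1
      ext x
      simp [hCdef, and_comm]
    have hzero : ∀ L : Measure E, L {0} = 0 → L.restrict C {0} = 0 := fun L hL =>
      nonpos_iff_eq_zero.1 ((Measure.restrict_le_self _).trans hL.le)
    have hle : ∀ L : Measure E, (∀ c, 0 < c → ∫⁻ x, radialWeight α p c x ∂L < ⊤) →
        ∀ c, 0 < c → ∫⁻ x, radialWeight α p c x ∂(L.restrict C) < ⊤ := fun L hL c hc =>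
      (setLIntegral_le_lintegral _ _).trans_lt (hL c hc)
    rw [hres, hres, map_withDensity_radialWeight_eq hp (hle M hMc) (hle N hNc)]
    refine ae_lintegral_radialWeight_eq (hzero M hM.2.1) (hzero N hN.2.1) ?_
    rw [← Upsilon_psiMeasure_restrict α p M hC hcone, ← Upsilon_psiMeasure_restrict α p N hC hcone,
      h]
  have hback : ∀ L : Measure E, ((L.withDensity (radialWeight α p 1)).map
      (fun x => (‖x‖⁻¹ • x, ‖x‖ ^ (-p)))).map (fun y => y.2 ^ (-1 / p) • y.1) =
      L.withDensity (radialWeight α p 1) := by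
    intro L
    rw [Measure.map_map mQ mP]
    convert! Measure.map_id
    ext x
    exact rpow_smul_polar hp x
  have hinv : ∀ L : Measure E, L {0} = 0 → (L.withDensity (radialWeight α p 1)).withDensity
      (fun x => (radialWeight α p 1 x)⁻¹) = L := by
    intro L hL
    refine withDensity_inv_same mw ?_ (ae_of_all _ fun x => ENNReal.ofReal_ne_top)
    have : ∀ᵐ x ∂L, x ≠ 0 := by simpa [ae_iff] using hL
    filter_upwards [this] with x hx
    have : 0 < ‖x‖ := norm_pos_iff.2 hx
    simp only [radialWeight, ne_eq, ENNReal.ofReal_eq_zero, not_le]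
    positivity
  rw [← hinv M hM.2.1, ← hinv N hN.2.1, ← hback M, ← hback N, hpolar]

theorem stmt14 (d : ℕ) (hd : 1 ≤ d) (β α p : ℝ) (hβα : β < α) (hα : α < 2) (hp : 0 < p) :
    Set.BijOn (Upsilon (tauMeasure β α p))
      (UpsilonRange (E := EuclideanSpace ℝ (Fin d)) (psiMeasure β p) ∩
        UpsilonDomain (tauMeasure β α p))
      (UpsilonRange (psiMeasure α p)) := by
  have hcomp : ∀ M : Measure (EuclideanSpace ℝ (Fin d)), IsLevyMeasure M →
      Upsilon (tauMeasure β α p) (Upsilon (psiMeasure β p) M) = Upsilon (psiMeasure α p) M :=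
    fun M hM => have := hM.1; Upsilon_tauMeasure_psiMeasure hβα hp M
  refine ⟨?_, ?_, ?_⟩
  · rintro _ ⟨⟨M, hM, rfl⟩, hN⟩
    have hlevy := hN.2
    rw [hcomp M hM.1] at hlevy ⊢
    exact ⟨M, ⟨hM.1, hlevy⟩, rfl⟩
  · rintro _ ⟨⟨M, hM, rfl⟩, hN⟩ _ ⟨⟨M', hM', rfl⟩, hN'⟩ h
    have hlevy := hN.2
    have hlevy' := hN'.2
    rw [hcomp M hM.1] at hlevy
    rw [hcomp M' hM'.1] at hlevy'
    rw [hcomp M hM.1, hcomp M' hM'.1] at h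
    rw [Upsilon_psiMeasure_injOn hp ⟨hM.1, hlevy⟩ ⟨hM'.1, hlevy'⟩ h]
  · rintro _ ⟨M, hM, rfl⟩
    have hβ := isLevyMeasure_Upsilon_psiMeasure hβα hα hp hM.1 hM.2
    refine ⟨Upsilon (psiMeasure β p) M, ⟨⟨M, ⟨hM.1, hβ⟩, rfl⟩, hβ, ?_⟩, hcomp M hM.1⟩
    rw [hcomp M hM.1]
    exact hM.2
end
end

section
/- Let d ≥ 1 and let ρ(ds) = g(s) 1_{s>0} ds for a nonnegative measurable g, and suppose there exist δ ∈ (0,1), α ∈ ℝ and 0 < a < b < ∞ with a < s^{α+1} g(s) < b for all s ∈ (0,δ); when α < 2 suppose additionally that ∫₀^∞ s² g(s) ds < ∞. Then the domain of the upsilon transform Υ_ρ is: 𝔐^0 (all Lévy measures on ℝ^d) if α < 0; 𝔐^log if α = 0; 𝔐^α if α ∈ (0,2); and {0} (only the zero measure) if α ≥ 2. -/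
open MeasureTheory Set

noncomputable section

variable {E : Type*} [NormedAddCommGroup E] [NormedSpace ℝ E]
  [MeasurableSpace E] [BorelSpace E]

/-- The truncated second moment `∫₀^∞ ((s r)² ∧ 1) g(s) ds` of the dilation of size `r` of the
measure `g(s) ds` on `(0,∞)`. -/
def truncMoment (g : ℝ → ℝ) (r : ℝ) : ENNReal :=
  ∫⁻ s in Ioi (0 : ℝ), ENNReal.ofReal (min ((s * r) ^ 2) 1 * g s)

lemma measurable_truncMoment {g : ℝ → ℝ} (hg : Measurable g) : Measurable (truncMoment g) := by
  unfold truncMoment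
  exact Measurable.lintegral_prod_right' (f := fun p : ℝ × ℝ =>
    ENNReal.ofReal (min ((p.2 * p.1) ^ 2) 1 * g p.2)) (by fun_prop)

lemma densMeasure_eq_restrict (g : ℝ → ℝ) :
    densMeasure g = ((volume : Measure ℝ).restrict (Ioi 0)).withDensity
      fun s => ENNReal.ofReal (g s) := by
  rw [← withDensity_indicator measurableSet_Ioi, densMeasure]
  rfl

instance sFinite_densMeasure (g : ℝ → ℝ) : SFinite (densMeasure g) := by
  rw [densMeasure_eq_restrict]; infer_instance

/-- The integral of `|x|² ∧ 1` against `Υ_ρ M`, by Tonelli. -/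
lemma lintegral_upsilon_densMeasure [SecondCountableTopology E] {g : ℝ → ℝ} (hg : Measurable g)
    (M : Measure E) [SFinite M] :
    ∫⁻ x, ENNReal.ofReal (min (‖x‖ ^ 2) 1) ∂(Upsilon (densMeasure g) M) =
      ∫⁻ x, truncMoment g ‖x‖ ∂M := by
  have hF : Measurable fun x : E => ENNReal.ofReal (min (‖x‖ ^ 2) 1) := by fun_prop
  have hm : Measurable fun sx : ℝ × E => sx.1 • sx.2 := by fun_prop
  rw [Upsilon, lintegral_map hF hm, lintegral_prod_symm' _
    (by fun_prop : Measurable fun sx : ℝ × E => ENNReal.ofReal (min (‖sx.1 • sx.2‖ ^ 2) 1))]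
  refine lintegral_congr fun x => ?_
  rw [densMeasure_eq_restrict, lintegral_withDensity_eq_lintegral_mul _ (by fun_prop)
    (by fun_prop), truncMoment]
  refine setLIntegral_congr_fun measurableSet_Ioi fun s hs => ?_
  simp only [Pi.mul_apply]
  rw [mul_comm, norm_smul, Real.norm_of_nonneg (le_of_lt hs), ENNReal.ofReal_mul (by positivity)]

lemma upsilon_densMeasure_singleton_zero [SecondCountableTopology E] (g : ℝ → ℝ)
    (M : Measure E) [SFinite M] (hM : M {0} = 0) : Upsilon (densMeasure g) M {0} = 0 := by
  have hm : Measurable fun sx : ℝ × E => sx.1 • sx.2 := by fun_prop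
  rw [Upsilon, Measure.map_apply hm (measurableSet_singleton 0)]
  have hρ : densMeasure g {0} = 0 := withDensity_absolutelyContinuous _ _ (by simp)
  refine measure_mono_null (t := ({0} : Set ℝ) ×ˢ univ ∪ univ ×ˢ ({0} : Set E)) ?_ ?_
  · rintro ⟨s, x⟩ h
    simpa [smul_eq_zero] using h
  · refine measure_union_null ?_ ?_ <;> simp [Measure.prod_prod, hM, hρ]

/-- A measure without mass at `0` that integrates a function positive off `0` is `σ`-finite. -/
lemma sigmaFinite_of_lintegral_norm_lt_top {F : Type*} [NormedAddCommGroup F] [MeasurableSpace F]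
    [BorelSpace F] {φ : ℝ → ℝ} (hφ : Measurable φ)
    (hpos : ∀ r, 0 < r → 0 < φ r) {M : Measure F} (h0 : M {0} = 0)
    (hfin : ∫⁻ x, ENNReal.ofReal (φ ‖x‖) ∂M < ⊤) : SigmaFinite M := by
  refine ⟨⟨⟨fun n => {0} ∪ {x | ((n : ENNReal) + 1)⁻¹ ≤ ENNReal.ofReal (φ ‖x‖)},
    fun _ => trivial, fun n => ?_, ?_⟩⟩⟩
  · refine (measure_union_le _ _).trans_lt ?_
    rw [h0, zero_add]
    refine (meas_ge_le_lintegral_div (by fun_prop) (by simp) (by simp)).trans_lt ?_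
    exact ENNReal.div_lt_top hfin.ne (by simp)
  · refine eq_univ_of_forall fun x => ?_
    rw [mem_iUnion]
    by_cases hx : x = 0
    · exact ⟨0, by simp [hx]⟩
    · obtain ⟨n, hn⟩ := ENNReal.exists_inv_nat_lt
        (ENNReal.ofReal_pos.2 (hpos ‖x‖ (norm_pos_iff.2 hx))).ne'
      exact ⟨n, Or.inr ((ENNReal.inv_le_inv.2 le_self_add).trans hn.le)⟩

lemma mem_upsilonDomain_iff [SecondCountableTopology E] {g : ℝ → ℝ} (hg : Measurable g)
    (M : Measure E) : M ∈ UpsilonDomain (densMeasure g) ↔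
      IsLevyMeasure M ∧ ∫⁻ x, truncMoment g ‖x‖ ∂M < ⊤ := by
  refine and_congr_right fun hM => ?_
  have := hM.1
  rw [← lintegral_upsilon_densMeasure hg M]
  refine ⟨fun h => h.2.2, fun h => ?_⟩
  have h0 := upsilon_densMeasure_singleton_zero g M hM.2.1
  exact ⟨sigmaFinite_of_lintegral_norm_lt_top (φ := fun r => min (r ^ 2) 1) (by fun_prop)
    (fun r hr => by positivity) h0 h, h0, h⟩

lemma lintegral_Ioc_rpow {p u : ℝ} (hp : -1 < p) (hu : 0 ≤ u) :
    ∫⁻ s in Ioc 0 u, ENNReal.ofReal (s ^ p) = ENNReal.ofReal (u ^ (p + 1) / (p + 1)) := by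
  rw [← ofReal_integral_eq_lintegral_ofReal, ← intervalIntegral.integral_of_le hu,
    integral_rpow (Or.inl hp), Real.zero_rpow (by linarith), sub_zero]
  · exact (intervalIntegrable_iff_integrableOn_Ioc_of_le hu).1
      (intervalIntegral.intervalIntegrable_rpow' hp)
  · exact (ae_restrict_mem measurableSet_Ioc).mono fun s hs => Real.rpow_nonneg hs.1.le p

lemma lintegral_Ioc_rpow_le {p u : ℝ} (hp : p < -1) (hu : 0 < u) (hu1 : u ≤ 1) :
    ∫⁻ s in Ioc u 1, ENNReal.ofReal (s ^ p) ≤ ENNReal.ofReal (u ^ (p + 1) / -(p + 1)) := by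
  have h0 : (0 : ℝ) ∉ uIcc u 1 := by
    rw [uIcc_of_le hu1]; exact fun h => hu.not_ge h.1
  rw [← ofReal_integral_eq_lintegral_ofReal, ← intervalIntegral.integral_of_le hu1,
    integral_rpow (Or.inr ⟨hp.ne, h0⟩), Real.one_rpow]
  · refine ENNReal.ofReal_le_ofReal ?_
    rw [← neg_div_neg_eq, neg_sub]
    have : 0 < -(p + 1) := by linarith
    gcongr
    linarith
  · exact (intervalIntegrable_iff_integrableOn_Ioc_of_le hu1).1
      (intervalIntegral.intervalIntegrable_rpow (Or.inr h0))
  · exact (ae_restrict_mem measurableSet_Ioc).mono fun s hs =>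
      Real.rpow_nonneg (hu.trans hs.1).le p

lemma lintegral_Ioc_rpow_neg_one {u v : ℝ} (hu : 0 < u) (huv : u ≤ v) :
    ∫⁻ s in Ioc u v, ENNReal.ofReal (s ^ (-1 : ℝ)) = ENNReal.ofReal (Real.log (v / u)) := by
  have h0 : (0 : ℝ) ∉ uIcc u v := by
    rw [uIcc_of_le huv]; exact fun h => hu.not_ge h.1
  simp_rw [Real.rpow_neg_one]
  rw [← ofReal_integral_eq_lintegral_ofReal, ← intervalIntegral.integral_of_le huv,
    integral_inv h0]
  · exact (intervalIntegrable_iff_integrableOn_Ioc_of_le huv).1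
      (intervalIntegrable_inv_iff.2 (Or.inr h0))
  · exact (ae_restrict_mem measurableSet_Ioc).mono fun s hs =>
      inv_nonneg.2 (hu.trans hs.1).le

lemma lintegral_Ioo_rpow_eq_top {p u : ℝ} (hp : p ≤ -1) (hu : 0 < u) :
    ∫⁻ s in Ioo 0 u, ENNReal.ofReal (s ^ p) = ⊤ := by
  by_contra h
  refine hp.not_gt ((intervalIntegral.integrableOn_Ioo_rpow_iff hu).1
    ((lintegral_ofReal_ne_top_iff_integrable (by fun_prop) ?_).1 h))
  exact (ae_restrict_mem measurableSet_Ioo).mono fun s hs => Real.rpow_nonneg hs.1.le p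

/-- The trivial bound by the second moment. -/
lemma truncMoment_le_sq {g : ℝ → ℝ} (hg0 : ∀ s, 0 ≤ g s) (r : ℝ) :
    truncMoment g r ≤
      ENNReal.ofReal (r ^ 2) * ∫⁻ s in Ioi (0 : ℝ), ENNReal.ofReal (s ^ 2 * g s) := by
  rw [truncMoment, ← lintegral_const_mul' _ _ ENNReal.ofReal_ne_top]
  refine lintegral_mono fun s => ?_
  rw [← ENNReal.ofReal_mul (by positivity)]
  refine ENNReal.ofReal_le_ofReal ?_
  rw [← mul_assoc, mul_comm (r ^ 2), ← mul_pow]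
  exact mul_le_mul_of_nonneg_right (min_le_left _ _) (hg0 s)

/-- Splitting at `δ`, with the part beyond `δ` controlled by the second moment. -/
lemma truncMoment_le_add {g : ℝ → ℝ} (hg0 : ∀ s, 0 ≤ g s) {δ α b : ℝ} (hδ : 0 < δ)
    (hδ1 : δ < 1) (hb : 0 ≤ b) (hbound : ∀ s ∈ Ioo (0 : ℝ) δ, s ^ (α + 1) * g s < b) (r : ℝ) :
    truncMoment g r ≤
      ENNReal.ofReal b *
        (∫⁻ s in Ioc (0 : ℝ) 1, ENNReal.ofReal (min ((s * r) ^ 2) 1 * s ^ (-α - 1))) +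
      ENNReal.ofReal (δ ^ 2)⁻¹ * ∫⁻ s in Ioi (0 : ℝ), ENNReal.ofReal (s ^ 2 * g s) := by
  rw [truncMoment, ← Ioo_union_Ici_eq_Ioi hδ]
  refine (lintegral_union_le _ _ _).trans (add_le_add ?_ ?_)
  · rw [← lintegral_const_mul' _ _ ENNReal.ofReal_ne_top]
    refine (setLIntegral_mono' measurableSet_Ioo fun s hs => ?_).trans
      (lintegral_mono_set fun s hs => ⟨hs.1, (hs.2.trans hδ1).le⟩)
    rw [← ENNReal.ofReal_mul hb]
    refine ENNReal.ofReal_le_ofReal ?_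
    have hg : g s ≤ b * s ^ (-α - 1) := by
      rw [show -α - 1 = -(α + 1) by ring, Real.rpow_neg hs.1.le, ← div_eq_mul_inv,
        le_div_iff₀ (Real.rpow_pos_of_pos hs.1 _), mul_comm]
      exact (hbound s hs).le
    calc min ((s * r) ^ 2) 1 * g s ≤ min ((s * r) ^ 2) 1 * (b * s ^ (-α - 1)) := by gcongr
      _ = b * (min ((s * r) ^ 2) 1 * s ^ (-α - 1)) := by ring
  · rw [Ioo_union_Ici_eq_Ioi hδ]
    refine le_trans ?_ (mul_le_mul_right (lintegral_mono_set (Ici_subset_Ioi.2 hδ)) _)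
    rw [← lintegral_const_mul' _ _ ENNReal.ofReal_ne_top]
    refine setLIntegral_mono' measurableSet_Ici fun s hs => ?_
    rw [← ENNReal.ofReal_mul (by positivity), ← mul_assoc]
    refine ENNReal.ofReal_le_ofReal (mul_le_mul_of_nonneg_right ?_ (hg0 s))
    refine (min_le_right _ _).trans ?_
    rw [← div_eq_inv_mul, one_le_div (by positivity)]
    exact pow_le_pow_left₀ hδ.le hs 2

lemma lintegral_trunc_rpow_le_of_neg {α : ℝ} (hα : α < 0) (r : ℝ) :
    ∫⁻ s in Ioc (0 : ℝ) 1, ENNReal.ofReal (min ((s * r) ^ 2) 1 * s ^ (-α - 1)) ≤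
      ENNReal.ofReal (-α)⁻¹ := by
  have h := lintegral_Ioc_rpow (p := -α - 1) (by linarith) zero_le_one
  rw [Real.one_rpow, show -α - 1 + 1 = -α by ring, one_div] at h
  rw [← h]
  refine setLIntegral_mono' measurableSet_Ioc fun s hs => ENNReal.ofReal_le_ofReal ?_
  exact mul_le_of_le_one_left (Real.rpow_nonneg hs.1.le _) (min_le_right _ _)

/-- For `r ≥ 1`, splitting at `1 / r`. -/
lemma lintegral_trunc_rpow_le {α : ℝ} (hα : α < 2) {r : ℝ} (hr : 1 ≤ r) :
    ∫⁻ s in Ioc (0 : ℝ) 1, ENNReal.ofReal (min ((s * r) ^ 2) 1 * s ^ (-α - 1)) ≤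
      ENNReal.ofReal (r ^ α / (2 - α)) + ∫⁻ s in Ioc r⁻¹ 1, ENNReal.ofReal (s ^ (-α - 1)) := by
  have hr0 : 0 < r := by linarith
  rw [← Ioc_union_Ioc_eq_Ioc (inv_nonneg.2 hr0.le) (inv_le_one_of_one_le₀ hr)]
  refine (lintegral_union_le _ _ _).trans (add_le_add ?_ ?_)
  · have h := lintegral_Ioc_rpow (p := 1 - α) (by linarith) (inv_nonneg.2 hr0.le)
    have hval : r ^ α / (2 - α) = r ^ 2 * (r⁻¹ ^ (1 - α + 1) / (1 - α + 1)) := by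
      rw [show 1 - α + 1 = 2 - α by ring, Real.inv_rpow hr0.le, ← Real.rpow_neg hr0.le,
        show -(2 - α) = α - 2 by ring, Real.rpow_sub hr0, Real.rpow_two]
      field_simp
    rw [hval, ENNReal.ofReal_mul (by positivity), ← h,
      ← lintegral_const_mul' _ _ ENNReal.ofReal_ne_top]
    refine setLIntegral_mono' measurableSet_Ioc fun s hs => ?_
    rw [← ENNReal.ofReal_mul (by positivity)]
    refine ENNReal.ofReal_le_ofReal ?_
    rw [show 1 - α = 2 + (-α - 1) by ring, Real.rpow_add hs.1, Real.rpow_two, ← mul_assoc,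
      mul_comm (r ^ 2), ← mul_pow]
    exact mul_le_mul_of_nonneg_right (min_le_left _ _) (Real.rpow_nonneg hs.1.le _)
  · refine setLIntegral_mono' measurableSet_Ioc fun s hs => ENNReal.ofReal_le_ofReal ?_
    exact mul_le_of_le_one_left (Real.rpow_nonneg ((inv_pos.2 hr0).trans hs.1).le _)
      (min_le_right _ _)

/-- Lower bound by the contribution of a subset of `(0, δ)`. -/
lemma le_truncMoment {g : ℝ → ℝ} {δ α a : ℝ} (ha : 0 ≤ a)
    (hbound : ∀ s ∈ Ioo (0 : ℝ) δ, a < s ^ (α + 1) * g s) {A : Set ℝ} (hA : MeasurableSet A)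
    (hAδ : A ⊆ Ioo 0 δ) (r : ℝ) :
    ENNReal.ofReal a * (∫⁻ s in A, ENNReal.ofReal (min ((s * r) ^ 2) 1 * s ^ (-α - 1))) ≤
      truncMoment g r := by
  rw [← lintegral_const_mul' _ _ ENNReal.ofReal_ne_top]
  refine (setLIntegral_mono' hA fun s hs => ?_).trans
    (lintegral_mono_set (fun s hs => (hAδ hs).1 : A ⊆ Ioi 0))
  have hs' := hAδ hs
  rw [← ENNReal.ofReal_mul ha]
  refine ENNReal.ofReal_le_ofReal ?_
  have hg : a * s ^ (-α - 1) ≤ g s := by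
    rw [show -α - 1 = -(α + 1) by ring, Real.rpow_neg hs'.1.le, ← div_eq_mul_inv,
      div_le_iff₀ (Real.rpow_pos_of_pos hs'.1 _), mul_comm]
    exact (hbound s hs').le
  calc a * (min ((s * r) ^ 2) 1 * s ^ (-α - 1)) = min ((s * r) ^ 2) 1 * (a * s ^ (-α - 1)) := by
        ring
    _ ≤ min ((s * r) ^ 2) 1 * g s := by gcongr

/-- Where `s r ≤ 1`, the truncation is inactive. -/
lemma sq_mul_le_truncMoment {g : ℝ → ℝ} {δ α a : ℝ} (ha : 0 ≤ a)
    (hbound : ∀ s ∈ Ioo (0 : ℝ) δ, a < s ^ (α + 1) * g s) {r u : ℝ} (hr : 0 < r) (hu : u ≤ δ)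
    (hur : u * r ≤ 1) :
    ENNReal.ofReal a * (ENNReal.ofReal (r ^ 2) *
      ∫⁻ s in Ioo 0 u, ENNReal.ofReal (s ^ (1 - α))) ≤ truncMoment g r := by
  refine le_trans (mul_le_mul_right ?_ _)
    (le_truncMoment ha hbound measurableSet_Ioo (Ioo_subset_Ioo_right hu) r)
  rw [← lintegral_const_mul' _ _ ENNReal.ofReal_ne_top]
  refine setLIntegral_mono' measurableSet_Ioo fun s hs => ?_
  have hsr : s * r ≤ 1 := (mul_le_mul_of_nonneg_right hs.2.le hr.le).trans hur
  have hs0 : 0 ≤ s * r := mul_nonneg hs.1.le hr.le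
  rw [min_eq_left (pow_le_one₀ hs0 hsr), ← ENNReal.ofReal_mul (by positivity)]
  refine ENNReal.ofReal_le_ofReal (le_of_eq ?_)
  rw [show 1 - α = 2 + (-α - 1) by ring, Real.rpow_add hs.1, Real.rpow_two]
  ring

lemma truncMoment_eq_top {g : ℝ → ℝ} {δ α a : ℝ} (hδ : 0 < δ) (ha : 0 < a)
    (hbound : ∀ s ∈ Ioo (0 : ℝ) δ, a < s ^ (α + 1) * g s) (hα : 2 ≤ α) {r : ℝ} (hr : 0 < r) :
    truncMoment g r = ⊤ := by
  have h := sq_mul_le_truncMoment ha.le hbound hr (min_le_left δ r⁻¹)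
    ((mul_le_mul_of_nonneg_right (min_le_right _ _) hr.le).trans (inv_mul_cancel₀ hr.ne').le)
  rw [lintegral_Ioo_rpow_eq_top (by linarith) (lt_min hδ (inv_pos.2 hr)),
    ENNReal.mul_top (by simpa using hr.ne'), ENNReal.mul_top (by simpa using ha)] at h
  exact top_le_iff.1 h

lemma rpow_le_mul_truncMoment {g : ℝ → ℝ} {δ α a : ℝ} (hδ : 0 < δ) (hδ1 : δ < 1) (ha : 0 < a)
    (hbound : ∀ s ∈ Ioo (0 : ℝ) δ, a < s ^ (α + 1) * g s) (hα : α < 2) {r : ℝ} (hr : 1 ≤ r) :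
    ENNReal.ofReal (r ^ α) ≤
      ENNReal.ofReal ((2 - α) / (a * δ ^ (2 - α))) * truncMoment g r := by
  have hr0 : 0 < r := by linarith
  have h2 : 0 < 2 - α := by linarith
  have hδp : 0 < δ ^ (2 - α) := Real.rpow_pos_of_pos hδ _
  have h := sq_mul_le_truncMoment ha.le hbound (u := δ / r) hr0 (div_le_self hδ.le hr)
    (by rw [div_mul_cancel₀ _ hr0.ne']; exact hδ1.le)
  rw [restrict_Ioo_eq_restrict_Ioc, lintegral_Ioc_rpow (by linarith) (by positivity),
    show 1 - α + 1 = 2 - α by ring, ← ENNReal.ofReal_mul (by positivity),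
    ← ENNReal.ofReal_mul ha.le] at h
  refine le_trans (le_of_eq ?_) (mul_le_mul_right h _)
  rw [← ENNReal.ofReal_mul (by positivity), Real.div_rpow hδ.le hr0.le, Real.rpow_sub hr0,
    Real.rpow_two]
  congr 1
  have : 0 < r ^ α := Real.rpow_pos_of_pos hr0 _
  field_simp

lemma log_le_truncMoment_add {g : ℝ → ℝ} {δ a : ℝ} (hδ : 0 < δ) (ha : 0 < a)
    (hbound : ∀ s ∈ Ioo (0 : ℝ) δ, a < s ^ ((0 : ℝ) + 1) * g s) {r : ℝ} (hr : 0 < r) :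
    ENNReal.ofReal (Real.log r) ≤
      ENNReal.ofReal a⁻¹ * truncMoment g r + ENNReal.ofReal (Real.log δ⁻¹) := by
  have hlog : Real.log r = Real.log (δ / r⁻¹) + Real.log δ⁻¹ := by
    rw [div_inv_eq_mul, Real.log_mul hδ.ne' hr.ne', Real.log_inv]; ring
  rw [hlog]
  refine ENNReal.ofReal_add_le.trans (add_le_add_left ?_ _)
  rcases le_total r⁻¹ δ with hrδ | hrδ
  · rw [← lintegral_Ioc_rpow_neg_one (inv_pos.2 hr) hrδ, ← restrict_Ioo_eq_restrict_Ioc]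
    have h := le_truncMoment ha.le hbound (A := Ioo r⁻¹ δ) measurableSet_Ioo
      (Ioo_subset_Ioo_left (inv_pos.2 hr).le) r
    refine le_trans ?_ (mul_le_mul_right h _)
    rw [← mul_assoc, ← ENNReal.ofReal_mul (inv_pos.2 ha).le, inv_mul_cancel₀ ha.ne',
      ENNReal.ofReal_one, one_mul]
    refine setLIntegral_mono' measurableSet_Ioo fun s hs => ENNReal.ofReal_le_ofReal ?_
    have hsr : 1 ≤ s * r := by
      have := mul_le_mul_of_nonneg_right hs.1.le hr.le
      rwa [inv_mul_cancel₀ hr.ne'] at this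
    rw [min_eq_right (one_le_pow₀ hsr)]
    simp
  · rw [ENNReal.ofReal_of_nonpos]
    · exact zero_le
    · exact Real.log_nonpos (by positivity) ((div_le_one (inv_pos.2 hr)).2 hrδ)

/-- Only integrability of the truncated moment off the unit ball matters. -/
lemma lintegral_truncMoment_lt_top {F : Type*} [NormedAddCommGroup F] [MeasurableSpace F]
    [BorelSpace F] {g : ℝ → ℝ} (hg0 : ∀ s, 0 ≤ g s)
    (hint : ∫⁻ s in Ioi (0 : ℝ), ENNReal.ofReal (s ^ 2 * g s) < ⊤) {M : Measure F}
    (hM : ∫⁻ x, ENNReal.ofReal (min (‖x‖ ^ 2) 1) ∂M < ⊤)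
    (hlarge : ∫⁻ x in {x : F | 1 < ‖x‖}, truncMoment g ‖x‖ ∂M < ⊤) :
    ∫⁻ x, truncMoment g ‖x‖ ∂M < ⊤ := by
  have hS : MeasurableSet {x : F | 1 < ‖x‖} := measurableSet_lt measurable_const measurable_norm
  rw [← lintegral_add_compl _ hS]
  refine ENNReal.add_lt_top.2 ⟨hlarge, ?_⟩
  refine lt_of_le_of_lt ?_ (ENNReal.mul_lt_top hM hint)
  rw [← lintegral_mul_const' _ _ hint.ne]
  refine (setLIntegral_mono' hS.compl fun x hx => ?_).trans (setLIntegral_le_lintegral _ _)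
  have hx1 : ‖x‖ ≤ 1 := not_lt.1 hx
  rw [min_eq_left (pow_le_one₀ (norm_nonneg x) hx1)]
  exact truncMoment_le_sq hg0 _

lemma measure_one_lt_norm_lt_top {F : Type*} [NormedAddCommGroup F] [MeasurableSpace F]
    [BorelSpace F] {M : Measure F}
    (hM : ∫⁻ x, ENNReal.ofReal (min (‖x‖ ^ 2) 1) ∂M < ⊤) : M {x : F | 1 < ‖x‖} < ⊤ := by
  have hS : MeasurableSet {x : F | 1 < ‖x‖} := measurableSet_lt measurable_const measurable_norm
  refine lt_of_le_of_lt ?_ hM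
  rw [← setLIntegral_one]
  refine (setLIntegral_mono' hS fun x hx => ?_).trans (setLIntegral_le_lintegral _ _)
  rw [min_eq_right (one_le_pow₀ (le_of_lt hx)), ENNReal.ofReal_one]

lemma MemMAlpha.isLevyMeasure {F : Type*} [NormedAddCommGroup F] [MeasurableSpace F]
    [BorelSpace F] {α : ℝ} (hα : 0 ≤ α) (hα2 : α ≤ 2) {M : Measure F} (hM : MemMAlpha α M) : IsLevyMeasure M := by
  refine ⟨sigmaFinite_of_lintegral_norm_lt_top (φ := fun r => min (r ^ 2) (r ^ α))
    (by fun_prop) (fun r hr => by positivity) hM.1 hM.2, hM.1, lt_of_le_of_lt ?_ hM.2⟩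
  refine lintegral_mono fun x => ENNReal.ofReal_le_ofReal (le_min (min_le_left _ _) ?_)
  rcases le_total ‖x‖ 1 with h | h
  · rw [← Real.rpow_two]
    exact (min_le_left _ _).trans
      (Real.rpow_le_rpow_of_exponent_ge' (norm_nonneg x) h hα hα2)
  · exact (min_le_right _ _).trans (Real.one_le_rpow h hα)

lemma isLevyMeasure_zero {F : Type*} [NormedAddCommGroup F] [MeasurableSpace F] :
    IsLevyMeasure (0 : Measure F) :=
  ⟨inferInstance, by simp, by simp⟩

theorem stmt18 (d : ℕ) (hd : 1 ≤ d) (g : ℝ → ℝ) (hgmeas : Measurable g) (hg0 : ∀ s, 0 ≤ g s)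
    (δ α a b : ℝ) (hδ : δ ∈ Ioo (0 : ℝ) 1) (ha : 0 < a) (hab : a < b)
    (hbound : ∀ s ∈ Ioo (0 : ℝ) δ, a < s ^ (α + 1) * g s ∧ s ^ (α + 1) * g s < b)
    (hint : α < 2 → ∫⁻ s in Ioi (0 : ℝ), ENNReal.ofReal (s ^ 2 * g s) < ⊤) :
    (α < 0 →
      UpsilonDomain (E := EuclideanSpace ℝ (Fin d)) (densMeasure g) =
        {M | IsLevyMeasure M}) ∧
    (α = 0 →
      UpsilonDomain (E := EuclideanSpace ℝ (Fin d)) (densMeasure g) =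
        {M | MemMLog M}) ∧
    (0 < α → α < 2 →
      UpsilonDomain (E := EuclideanSpace ℝ (Fin d)) (densMeasure g) =
        {M | MemMAlpha α M}) ∧
    (2 ≤ α →
      UpsilonDomain (E := EuclideanSpace ℝ (Fin d)) (densMeasure g) = {0}) := by
  obtain ⟨hδ0, hδ1⟩ := hδ
  have hb : 0 ≤ b := (ha.trans hab).le
  have hlow := fun s hs => (hbound s hs).1
  have hsplit := truncMoment_le_add hg0 hδ0 hδ1 hb fun s hs => (hbound s hs).2
  have hS : MeasurableSet {x : EuclideanSpace ℝ (Fin d) | 1 < ‖x‖} :=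
    measurableSet_lt measurable_const measurable_norm
  refine ⟨fun hα => ?_, fun hα => ?_, fun hα0 hα => ?_, fun hα => ?_⟩ <;> ext M <;>
    rw [mem_upsilonDomain_iff hgmeas M]
  · have hint := hint (by linarith)
    refine ⟨fun h => h.1, fun hM => ⟨hM, lintegral_truncMoment_lt_top hg0 hint hM.2.2 ?_⟩⟩
    refine lt_of_le_of_lt (lintegral_mono fun x => (hsplit ‖x‖).trans <| add_le_add_left
      (mul_le_mul_right (lintegral_trunc_rpow_le_of_neg hα _) _) _) ?_
    rw [setLIntegral_const]
    refine ENNReal.mul_lt_top (ENNReal.add_lt_top.2 ⟨?_, ?_⟩) (measure_one_lt_norm_lt_top hM.2.2)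
    · exact ENNReal.mul_lt_top ENNReal.ofReal_lt_top ENNReal.ofReal_lt_top
    · exact ENNReal.mul_lt_top ENNReal.ofReal_lt_top hint
  · subst hα
    have hint := hint two_pos
    refine and_congr_right fun hM => ⟨fun h => ?_, fun h =>
      lintegral_truncMoment_lt_top hg0 hint hM.2.2 ?_⟩
    · refine lt_of_le_of_lt (setLIntegral_mono' hS fun x hx =>
        log_le_truncMoment_add hδ0 ha hlow (zero_lt_one.trans hx)) ?_
      rw [lintegral_add_right _ measurable_const, setLIntegral_const,
        lintegral_const_mul' _ _ ENNReal.ofReal_ne_top]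
      refine ENNReal.add_lt_top.2 ⟨ENNReal.mul_lt_top ENNReal.ofReal_lt_top
        ((setLIntegral_le_lintegral _ _).trans_lt h),
        ENNReal.mul_lt_top ENNReal.ofReal_lt_top (measure_one_lt_norm_lt_top hM.2.2)⟩
    · have hlog : ∀ x ∈ {x : EuclideanSpace ℝ (Fin d) | 1 < ‖x‖}, truncMoment g ‖x‖ ≤
          ENNReal.ofReal b * (ENNReal.ofReal (1 / 2) + ENNReal.ofReal (Real.log ‖x‖)) +
          ENNReal.ofReal (δ ^ 2)⁻¹ * ∫⁻ s in Ioi (0 : ℝ), ENNReal.ofReal (s ^ 2 * g s) := by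
        intro x hx
        refine (hsplit ‖x‖).trans (add_le_add_left (mul_le_mul_right ?_ _) _)
        have h1 := lintegral_trunc_rpow_le (α := 0) two_pos (le_of_lt hx)
        have h2 := lintegral_Ioc_rpow_neg_one (inv_pos.2 (zero_lt_one.trans hx))
          (inv_le_one_of_one_le₀ (le_of_lt hx))
        rw [one_div, inv_inv] at h2
        simpa only [neg_zero, zero_sub, h2, Real.rpow_zero, sub_zero] using h1
      refine lt_of_le_of_lt (setLIntegral_mono' hS hlog) ?_
      rw [lintegral_add_right _ measurable_const, setLIntegral_const,
        lintegral_const_mul' _ _ ENNReal.ofReal_ne_top, lintegral_add_left measurable_const,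
        setLIntegral_const]
      have hfin := measure_one_lt_norm_lt_top hM.2.2
      exact ENNReal.add_lt_top.2 ⟨ENNReal.mul_lt_top ENNReal.ofReal_lt_top
        (ENNReal.add_lt_top.2 ⟨ENNReal.mul_lt_top ENNReal.ofReal_lt_top hfin, h⟩),
        ENNReal.mul_lt_top (ENNReal.mul_lt_top ENNReal.ofReal_lt_top hint) hfin⟩
  · have hint := hint hα
    refine ⟨fun ⟨hM, h⟩ => ⟨hM.2.1, ?_⟩, fun hMα => ?_⟩
    · refine lt_of_le_of_lt (b := ∫⁻ x, (ENNReal.ofReal (min (‖x‖ ^ 2) 1) +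
        ENNReal.ofReal ((2 - α) / (a * δ ^ (2 - α))) * truncMoment g ‖x‖) ∂M)
        (lintegral_mono fun x => ?_) ?_
      · rcases le_total ‖x‖ 1 with hx | hx
        · refine le_add_right (ENNReal.ofReal_le_ofReal ?_)
          rw [min_eq_left (pow_le_one₀ (norm_nonneg x) hx)]
          exact min_le_left _ _
        · exact le_add_left ((ENNReal.ofReal_le_ofReal (min_le_right _ _)).trans
            (rpow_le_mul_truncMoment hδ0 hδ1 ha hlow hα hx))
      · rw [lintegral_add_left (by fun_prop), lintegral_const_mul' _ _ ENNReal.ofReal_ne_top]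
        exact ENNReal.add_lt_top.2 ⟨hM.2.2, ENNReal.mul_lt_top ENNReal.ofReal_lt_top h⟩
    · have hM := MemMAlpha.isLevyMeasure hα0.le hα.le hMα
      refine ⟨hM, lintegral_truncMoment_lt_top hg0 hint hM.2.2 ?_⟩
      have hpow : ∀ x ∈ {x : EuclideanSpace ℝ (Fin d) | 1 < ‖x‖}, truncMoment g ‖x‖ ≤
          ENNReal.ofReal (b * (1 / (2 - α) + 1 / α)) *
            ENNReal.ofReal (min (‖x‖ ^ 2) (‖x‖ ^ α)) +
          ENNReal.ofReal (δ ^ 2)⁻¹ * ∫⁻ s in Ioi (0 : ℝ), ENNReal.ofReal (s ^ 2 * g s) := by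
        intro x hx
        have hx0 : 0 < ‖x‖ := zero_lt_one.trans hx
        have hxα : 0 ≤ ‖x‖ ^ α := Real.rpow_nonneg hx0.le _
        have h2α : 0 < 2 - α := by linarith
        refine (hsplit ‖x‖).trans (add_le_add_left ?_ _)
        rw [ENNReal.ofReal_mul hb, mul_assoc]
        refine mul_le_mul_right ?_ _
        have h1 := lintegral_trunc_rpow_le hα (le_of_lt hx)
        have h2 := lintegral_Ioc_rpow_le (p := -α - 1) (by linarith) (inv_pos.2 hx0)
          (inv_le_one_of_one_le₀ (le_of_lt hx))
        rw [show -α - 1 + 1 = -α by ring, neg_neg, Real.inv_rpow hx0.le,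
          Real.rpow_neg hx0.le, inv_inv] at h2
        refine (h1.trans (add_le_add_right h2 _)).trans (le_of_eq ?_)
        have hmin : min (‖x‖ ^ 2) (‖x‖ ^ α) = ‖x‖ ^ α := by
          rw [← Real.rpow_two]
          exact min_eq_right (Real.rpow_le_rpow_of_exponent_le (le_of_lt hx) hα.le)
        rw [hmin, ← ENNReal.ofReal_add (by positivity) (by positivity),
          ← ENNReal.ofReal_mul (by positivity)]
        congr 1
        ring
      refine lt_of_le_of_lt (setLIntegral_mono' hS hpow) ?_
      rw [lintegral_add_right _ measurable_const, setLIntegral_const,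
        lintegral_const_mul' _ _ ENNReal.ofReal_ne_top]
      exact ENNReal.add_lt_top.2 ⟨ENNReal.mul_lt_top ENNReal.ofReal_lt_top
        ((setLIntegral_le_lintegral _ _).trans_lt hMα.2),
        ENNReal.mul_lt_top (ENNReal.mul_lt_top ENNReal.ofReal_lt_top hint)
          (measure_one_lt_norm_lt_top hM.2.2)⟩
  · constructor
    · rintro ⟨hM, h⟩
      have hae := ae_lt_top ((measurable_truncMoment hgmeas).comp measurable_norm) h.ne
      have hM0 : ∀ᵐ x ∂M, x ≠ 0 := by simpa [ae_iff] using hM.2.1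
      refine ae_eq_bot.1 (Filter.eventually_false_iff_eq_bot.1 ?_)
      filter_upwards [hae, hM0] with x hx hx0
      exact hx.ne (truncMoment_eq_top hδ0 ha hlow hα (norm_pos_iff.2 hx0))
    · rintro rfl
      exact ⟨isLevyMeasure_zero, by simp⟩
end
end
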